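/- Let M be a monoid. Then M has a left absorbing element if and only if for every index type I and every family (X_i)_{i ∈ I} of indecomposable right M-sets, the product Π_{i ∈ I} X_i, equipped with the pointwise action ((x_i) · m)_i = (x_i · m), is an indecomposable right M-set. -/

import Mathlib

/-- Two elements of a right `M`-set are connected: related by the equivalence relation
generated by the pairs `(x, x · m)`. -/
def MConn (M : Type*) [Monoid M] {X : Type*} [MulAction Mᵐᵒᵖ X] (a b : X) : Prop :=
  Relation.EqvGen (fun x y => ∃ m : M, y = MulOpposite.op m • x) a b

/-- A right `M`-set is indecomposable if nonempty and any two elements are connected. -/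
def MIndec (M : Type*) [Monoid M] (X : Type*) [MulAction Mᵐᵒᵖ X] : Prop :=
  Nonempty X ∧ ∀ a b : X, MConn M a b

open MulOpposite

section Connected

variable {M : Type*} [Monoid M] {X : Type*} [MulAction Mᵐᵒᵖ X]

theorem MConn.refl (a : X) : MConn M a a := Relation.EqvGen.refl a

theorem MConn.symm {a b : X} (h : MConn M a b) : MConn M b a := Relation.EqvGen.symm _ _ h

theorem MConn.trans {a b c : X} (hab : MConn M a b) (hbc : MConn M b c) : MConn M a c :=
  Relation.EqvGen.trans _ _ _ hab hbc

theorem MConn.smul (a : X) (m : M) : MConn M a (op m • a) :=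
  Relation.EqvGen.rel _ _ ⟨m, rfl⟩

theorem MIndec.of_forall_conn (x : X) (h : ∀ y, MConn M x y) : MIndec M X :=
  ⟨⟨x⟩, fun a b => (h a).symm.trans (h b)⟩

theorem MConn.smul_eq_of_absorbing {l : M} (hl : ∀ m : M, m * l = l) {a b : X}
    (h : MConn M a b) : op l • a = op l • b := by
  induction h with
  | rel x y h =>
    obtain ⟨m, rfl⟩ := h
    rw [← mul_smul, ← op_mul, hl]
  | refl => rfl
  | symm _ _ _ ih => exact ih.symm
  | trans _ _ _ _ _ ih₁ ih₂ => exact ih₁.trans ih₂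

/-- If any two principal right ideals meet, connected elements have a common multiple. -/
theorem MConn.exists_smul_eq (hM : ∀ p q : M, ∃ u v, p * u = q * v) {a b : X}
    (h : MConn M a b) : ∃ m n : M, op m • a = op n • b := by
  induction h with
  | rel x y h =>
    obtain ⟨m, rfl⟩ := h
    exact ⟨m, 1, by simp⟩
  | refl => exact ⟨1, 1, rfl⟩
  | symm _ _ _ ih =>
    obtain ⟨m, n, h⟩ := ih
    exact ⟨n, m, h.symm⟩
  | trans x y z _ _ ih₁ ih₂ =>
    obtain ⟨m, n, h⟩ := ih₁
    obtain ⟨m', n', h'⟩ := ih₂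
    obtain ⟨u, v, huv⟩ := hM n m'
    refine ⟨m * u, n' * v, ?_⟩
    rw [op_mul, mul_smul, h, ← mul_smul, ← op_mul, huv, op_mul, mul_smul, h', ← mul_smul,
      ← op_mul]

end Connected

/-- Any monoid is indecomposable as a right set over itself. -/
theorem MIndec.self (M : Type*) [Monoid M] : MIndec M M :=
  .of_forall_conn 1 fun a => by simpa using MConn.smul (1 : M) a

theorem MConn.exists_dist_le {M ι : Type*} [Monoid M] {X : ι → Type*}
    [∀ i, MulAction Mᵐᵒᵖ (X i)] (f : ∀ i, X i → ℕ)
    (hf : ∀ i x (m : M), Nat.dist (f i x) (f i (op m • x)) ≤ 1)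
    {a b : ∀ i, X i} (h : MConn M a b) : ∃ K, ∀ i, Nat.dist (f i (a i)) (f i (b i)) ≤ K := by
  induction h with
  | rel x y h =>
    obtain ⟨m, rfl⟩ := h
    exact ⟨1, fun i => hf i (x i) m⟩
  | refl => exact ⟨0, fun i => by simp⟩
  | symm _ _ _ ih =>
    obtain ⟨K, h⟩ := ih
    exact ⟨K, fun i => by rw [Nat.dist_comm]; exact h i⟩
  | trans x y z _ _ ih₁ ih₂ =>
    obtain ⟨K, h⟩ := ih₁
    obtain ⟨L, h'⟩ := ih₂
    exact ⟨K + L, fun i =>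
      (Nat.dist.triangle_inequality _ (f i (y i)) _).trans (add_le_add (h i) (h' i))⟩

section Chain

variable {M : Type*} [Monoid M]

/-- The gluing relation identifying the `n`-th and `n + 1`-st copies of `M` along the right ideal
generated by `g n`. -/
def ChainRel (g : ℕ → M) (x y : ℕ × M) : Prop :=
  y = (x.1 + 1, x.2) ∧ g x.1 ∣ x.2

/-- Copies of `M` indexed by `ℕ`, each glued to the next along the right ideal generated by
`g n`. -/
def Chain (g : ℕ → M) : Type _ := Quot (ChainRel g)

namespace Chain

variable {g : ℕ → M}

/-- The class of `a` in the `n`-th copy of `M`. -/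
def mk (g : ℕ → M) (n : ℕ) (a : M) : Chain g := Quot.mk _ (n, a)

theorem mk_succ {n : ℕ} {a : M} (h : g n ∣ a) : mk g n a = mk g (n + 1) a :=
  Quot.sound ⟨rfl, h⟩

instance : MulAction Mᵐᵒᵖ (Chain g) where
  smul m := Quot.map (fun x => (x.1, x.2 * m.unop)) fun x y ⟨h, hd⟩ => by
    subst h
    exact ⟨rfl, hd.mul_right _⟩
  one_smul x := by
    obtain ⟨n, a⟩ := x
    exact congrArg (mk g n) (mul_one a)
  mul_smul m₁ m₂ x := by
    obtain ⟨n, a⟩ := x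
    exact congrArg (mk g n) (mul_assoc a m₂.unop m₁.unop).symm

theorem op_smul_mk (n : ℕ) (a m : M) : op m • mk g n a = mk g n (a * m) := rfl

theorem conn_mk (n : ℕ) (a : M) : MConn M (mk g n 1) (mk g n a) := by
  simpa [op_smul_mk] using MConn.smul (mk g n 1) a

theorem indec : MIndec M (Chain g) := by
  have h : ∀ n, MConn M (mk g 0 1) (mk g n 1) := by
    intro n
    induction n with
    | zero => exact .refl _
    | succ n ih =>
      refine (ih.trans (conn_mk n (g n))).trans ?_
      rw [mk_succ dvd_rfl]
      exact (conn_mk _ _).symm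
  refine .of_forall_conn (mk g 0 1) fun y => ?_
  obtain ⟨n, a⟩ := y
  exact (h n).trans (conn_mk n a)

open Classical in
/-- The position of an element along the chain. -/
noncomputable def pos (hg : ∀ n a, g n ∣ a → ¬ g (n + 1) ∣ a) : Chain g → ℕ :=
  Quot.lift (fun x => if g x.1 ∣ x.2 then x.1 + 1 else x.1) fun x y ⟨h, hd⟩ => by
    subst h
    simp [hd, hg _ _ hd]

open Classical in
theorem pos_mk (hg : ∀ n a, g n ∣ a → ¬ g (n + 1) ∣ a) (n : ℕ) (a : M) :
    pos hg (mk g n a) = if g n ∣ a then n + 1 else n := rfl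

theorem dist_pos_smul_le (hg : ∀ n a, g n ∣ a → ¬ g (n + 1) ∣ a) (x : Chain g) (m : M) :
    Nat.dist (pos hg x) (pos hg (op m • x)) ≤ 1 := by
  obtain ⟨n, a⟩ := x
  change Nat.dist (pos hg (mk g n a)) (pos hg (mk g n (a * m))) ≤ 1
  rw [pos_mk, pos_mk, Nat.dist]
  split_ifs <;> omega

end Chain

end Chain

/-- If all powers of indecomposable right sets are indecomposable, any two principal right ideals
meet. -/
theorem exists_mul_eq_mul_of_indec_pi {M : Type u} [Monoid M]
    (H : ∀ (I X : Type u) [MulAction Mᵐᵒᵖ X], MIndec M X → MIndec M (I → X)) (p q : M) :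
    ∃ u v, p * u = q * v := by
  by_contra! hpq
  let g : ℕ → M := fun n => if Even n then p else q
  have hg : ∀ n a, g n ∣ a → ¬ g (n + 1) ∣ a := by
    rintro n a ⟨u, hu⟩ ⟨v, hv⟩
    by_cases hn : Even n
    · simp only [g, hn, Nat.even_add_one, if_true, not_true, if_false] at hu hv
      exact hpq u v (hu.symm.trans hv)
    · simp only [g, hn, Nat.even_add_one, if_true, not_false_eq_true, if_false] at hu hv
      exact hpq v u (hv.symm.trans hu)
  obtain ⟨K, hK⟩ := MConn.exists_dist_le (fun _ => Chain.pos hg)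
    (fun _ => Chain.dist_pos_smul_le hg) <|
    (H (ULift ℕ) (Chain g) Chain.indec).2 (fun _ => Chain.mk g 0 1)
      (fun n => Chain.mk g n.down 1)
  have h := hK ⟨K + 2⟩
  rw [Chain.pos_mk, Chain.pos_mk, Nat.dist] at h
  dsimp only at h
  split_ifs at h <;> omega

theorem stmt17 (M : Type u) [Monoid M] :
    (∃ l : M, ∀ m : M, m * l = l) ↔
      ∀ (I : Type u) (X : I → Type u) [∀ i, MulAction Mᵐᵒᵖ (X i)],
        (∀ i, MIndec M (X i)) → MIndec M (∀ i, X i) := by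
  constructor
  · rintro ⟨l, hl⟩ I X _ hX
    refine ⟨⟨fun i => (hX i).1.some⟩, fun a b => ?_⟩
    have h : op l • a = op l • b :=
      funext fun i => ((hX i).2 (a i) (b i)).smul_eq_of_absorbing hl
    exact (MConn.smul a l).trans (h ▸ (MConn.smul b l).symm)
  · intro H
    obtain ⟨m, n, h⟩ := MConn.exists_smul_eq
      (exists_mul_eq_mul_of_indec_pi fun I X _ hX => H I (fun _ => X) fun _ => hX)
      ((H M (fun _ => M) fun _ => .self M).2 (fun _ => 1) id)
    have key : ∀ a : M, m = a * n := fun a => by simpa using congrFun h a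
    have hmn : m = n := by simpa using key 1
    exact ⟨m, fun a => by rw [hmn, ← key a, hmn]⟩
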